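/- Let Q be a probability measure equivalent to P on 𝒢 with density ρ = dQ/dP, and set e_t = E_P[ρ | F_t], E_t = E_P[ρ | G_t] and η_t = e_t / E_t (well defined since E_t > 0 almost surely). If F is immersed in G under P, then (η_t) is a (G,Q)-martingale. If moreover F is also immersed in G under Q, then for every (F,Q)-martingale (m_t), the product process (m_t · η_t) is a (G,Q)-martingale. -/

import Mathlib

open MeasureTheory Set
open scoped NNReal ENNReal

noncomputable section

namespace DefaultTimes

variable {Ω : Type*}

/-- The progressively enlarged filtration
`G_t = ⋂_{u>t} (F_u ∨ σ(τ ∧ s : s ≤ u))`. -/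
def enlargedFiltration {m0 : MeasurableSpace Ω}
    (F : Filtration ℝ≥0 m0) (τ : Ω → ℝ≥0∞) (hτ : Measurable τ) :
    Filtration ℝ≥0 m0 where
  seq t := ⨅ u ∈ Set.Ioi t, (F u ⊔ ⨆ s ∈ Set.Iic u,
      MeasurableSpace.comap (fun ω => min (τ ω) (s : ℝ≥0∞)) inferInstance)
  mono' := fun i j hij => le_iInf₂ fun u hu => iInf₂_le u (lt_of_le_of_lt hij hu)
  le' := fun t => by
    refine le_trans (iInf₂_le (t + 1) (lt_add_of_pos_right t one_pos)) ?_
    exact sup_le (Filtration.le _ _)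
      (iSup₂_le fun s _ => Measurable.comap_le (hτ.min measurable_const))

/-- `F` is immersed in `G` under `μ` ((H)-hypothesis): every `(F,μ)`-martingale is
a `(G,μ)`-martingale. -/
def Immersion {m0 : MeasurableSpace Ω} (F G : Filtration ℝ≥0 m0) (μ : Measure Ω) : Prop :=
  ∀ f : ℝ≥0 → Ω → ℝ, Martingale f F μ → Martingale f G μ

/-- On a sub-σ-algebra, the density `ρ` may be replaced by its conditional expectation. -/
lemma trim_withDensity_condExp {m m0 : MeasurableSpace Ω} (hm : m ≤ m0)
    {P : Measure Ω} [IsFiniteMeasure P] {ρ : Ω → ℝ} (hρ_pos : 0 ≤ ρ) (hρ_int : Integrable ρ P) :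
    (P.withDensity fun ω => ENNReal.ofReal (ρ ω)).trim hm =
      (P.withDensity fun ω => ENNReal.ofReal ((P[ρ|m]) ω)).trim hm := by
  refine @Measure.ext _ m _ _ fun s hs => ?_
  rw [trim_measurableSet_eq hm hs, trim_measurableSet_eq hm hs, withDensity_apply _ (hm s hs),
    withDensity_apply _ (hm s hs),
    ← ofReal_integral_eq_lintegral_ofReal hρ_int.restrict (ae_of_all _ hρ_pos),
    ← ofReal_integral_eq_lintegral_ofReal integrable_condExp.restrict
      (ae_restrict_of_ae (condExp_nonneg (ae_of_all _ hρ_pos))),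
    setIntegral_condExp hm hρ_int hs]

lemma integrable_withDensity_iff_integrable_mul_condExp {m m0 : MeasurableSpace Ω}
    (hm : m ≤ m0)
    {P : Measure Ω} [IsFiniteMeasure P] {ρ : Ω → ℝ} (hρ_pos : 0 ≤ ρ) (hρ_int : Integrable ρ P)
    {X : Ω → ℝ} (hX : StronglyMeasurable[m] X) :
    Integrable X (P.withDensity fun ω => ENNReal.ofReal (ρ ω)) ↔
      Integrable (fun ω => X ω * (P[ρ|m]) ω) P := by
  have hE : Measurable (P[ρ|m]) := (stronglyMeasurable_condExp.mono hm).measurable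
  have hcongr : (fun ω => (ENNReal.ofReal ((P[ρ|m]) ω)).toReal • X ω) =ᵐ[P]
      fun ω => X ω * (P[ρ|m]) ω := by
    filter_upwards [condExp_nonneg (m := m) (ae_of_all P hρ_pos)] with ω hω
    rw [ENNReal.toReal_ofReal hω, smul_eq_mul, mul_comm]
  rw [← integrable_congr hcongr, ← integrable_withDensity_iff_integrable_smul'
    hE.ennreal_ofReal (ae_of_all _ fun _ => ENNReal.ofReal_lt_top)]
  have htrim := trim_withDensity_condExp hm hρ_pos hρ_int
  exact ⟨fun h => integrable_of_integrable_trim hm (htrim ▸ h.trim hm hX),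
    fun h => integrable_of_integrable_trim hm (htrim ▸ h.trim hm hX)⟩

lemma setIntegral_withDensity_eq_setIntegral_mul_condExp {m m0 : MeasurableSpace Ω}
    (hm : m ≤ m0)
    {P : Measure Ω} [IsFiniteMeasure P] {ρ : Ω → ℝ} (hρ_pos : 0 ≤ ρ) (hρ_int : Integrable ρ P)
    {X : Ω → ℝ} (hX : StronglyMeasurable[m] X) {s : Set Ω} (hs : MeasurableSet[m] s) :
    ∫ ω in s, X ω ∂(P.withDensity fun ω => ENNReal.ofReal (ρ ω)) =
      ∫ ω in s, X ω * (P[ρ|m]) ω ∂P := by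
  have hE : Measurable (P[ρ|m]) := (stronglyMeasurable_condExp.mono hm).measurable
  have hcongr : (fun ω => (ENNReal.ofReal ((P[ρ|m]) ω)).toReal • X ω) =ᵐ[P]
      fun ω => X ω * (P[ρ|m]) ω := by
    filter_upwards [condExp_nonneg (m := m) (ae_of_all P hρ_pos)] with ω hω
    rw [ENNReal.toReal_ofReal hω, smul_eq_mul, mul_comm]
  rw [← integral_congr_ae (ae_restrict_of_ae hcongr), setIntegral_trim hm hX hs,
    trim_withDensity_condExp hm hρ_pos hρ_int, ← setIntegral_trim hm hX hs,
    setIntegral_withDensity_eq_setIntegral_toReal_smul hE.ennreal_ofReal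
      (ae_of_all _ fun _ => ENNReal.ofReal_lt_top) _ (hm s hs)]

/-- A process is a martingale iff it is adapted, integrable, and its integrals over sets of the
past do not change. -/
lemma martingale_iff_setIntegral_eq {m0 : MeasurableSpace Ω} {H : Filtration ℝ≥0 m0}
    {μ : Measure Ω} [IsFiniteMeasure μ] {f : ℝ≥0 → Ω → ℝ} (hf : StronglyAdapted H f) :
    Martingale f H μ ↔ (∀ t, Integrable (f t) μ) ∧
      ∀ i j, i ≤ j → ∀ s, MeasurableSet[H i] s → ∫ ω in s, f i ω ∂μ = ∫ ω in s, f j ω ∂μ := by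
  refine ⟨fun h => ⟨h.integrable, fun i j hij s hs => h.setIntegral_eq hij hs⟩,
    fun ⟨hint, heq⟩ => ⟨hf, fun i j hij => ?_⟩⟩
  exact (ae_eq_condExp_of_forall_setIntegral_eq (H.le i) (hint j)
    (fun _ _ _ => (hint i).integrableOn) (fun s hs _ => heq i j hij s hs)
    (hf i).aestronglyMeasurable).symm

/-- **Bayes rule** for martingales: an adapted process is a martingale under the measure with
density `ρ` iff its product with the density process is a martingale. -/
lemma martingale_withDensity_iff {m0 : MeasurableSpace Ω} {H : Filtration ℝ≥0 m0}
    {P : Measure Ω} [IsFiniteMeasure P] {ρ : Ω → ℝ} (hρ_pos : 0 ≤ ρ) (hρ_int : Integrable ρ P)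
    {X : ℝ≥0 → Ω → ℝ} (hX : StronglyAdapted H X) :
    Martingale X H (P.withDensity fun ω => ENNReal.ofReal (ρ ω)) ↔
      Martingale (fun t ω => X t ω * (P[ρ|H t]) ω) H P := by
  have : IsFiniteMeasure (P.withDensity fun ω => ENNReal.ofReal (ρ ω)) :=
    isFiniteMeasure_withDensity_ofReal hρ_int.2
  have hXE : StronglyAdapted H fun t ω => X t ω * (P[ρ|H t]) ω :=
    fun t => (hX t).mul stronglyMeasurable_condExp
  rw [martingale_iff_setIntegral_eq hX, martingale_iff_setIntegral_eq hXE]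
  refine and_congr (forall_congr' fun t =>
    integrable_withDensity_iff_integrable_mul_condExp (H.le t) hρ_pos hρ_int (hX t))
    (forall₂_congr fun i j => forall_congr' fun hij => forall₂_congr fun s hs => ?_)
  rw [setIntegral_withDensity_eq_setIntegral_mul_condExp (H.le i) hρ_pos hρ_int (hX i) hs,
    setIntegral_withDensity_eq_setIntegral_mul_condExp (H.le j) hρ_pos hρ_int (hX j)
      (H.mono hij s hs)]

lemma martingale_congr_ae {m0 : MeasurableSpace Ω} {H : Filtration ℝ≥0 m0}
    {μ : Measure Ω} {f g : ℝ≥0 → Ω → ℝ} (hf : Martingale f H μ) (hg : StronglyAdapted H g)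
    (hfg : ∀ t, f t =ᵐ[μ] g t) : Martingale g H μ :=
  ⟨hg, fun i j hij => (condExp_congr_ae (hfg j).symm).trans ((hf.2 i j hij).trans (hfg i))⟩

lemma le_enlargedFiltration {m0 : MeasurableSpace Ω}
    (F : Filtration ℝ≥0 m0) (τ : Ω → ℝ≥0∞) (hτ : Measurable τ) :
    F ≤ enlargedFiltration F τ hτ :=
  fun _ => le_iInf₂ fun _ hu => (F.mono (le_of_lt hu)).trans le_sup_left

theorem stmt_19 {m0 : MeasurableSpace Ω} (P : Measure Ω) [IsProbabilityMeasure P]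
    (F : Filtration ℝ≥0 m0) (τ : Ω → ℝ≥0∞) (hτ : Measurable τ)
    (ρ : Ω → ℝ) (hρ_meas : Measurable ρ) (hρ_pos : ∀ ω, 0 < ρ ω)
    (hρ_int : Integrable ρ P) (hρ_one : ∫ ω, ρ ω ∂P = 1)
    (Q : Measure Ω) (hQ : Q = P.withDensity fun ω => ENNReal.ofReal (ρ ω))
    (hE_pos : ∀ t : ℝ≥0, ∀ᵐ ω ∂P, 0 < (P[ρ|enlargedFiltration F τ hτ t]) ω)
    (η : ℝ≥0 → Ω → ℝ)
    (hη : ∀ t ω, η t ω = (P[ρ|F t]) ω / (P[ρ|enlargedFiltration F τ hτ t]) ω)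
    (hImmP : Immersion F (enlargedFiltration F τ hτ) P) :
    Martingale η (enlargedFiltration F τ hτ) Q ∧
      (Immersion F (enlargedFiltration F τ hτ) Q →
        ∀ m : ℝ≥0 → Ω → ℝ, Martingale m F Q →
          Martingale (fun t ω => m t ω * η t ω) (enlargedFiltration F τ hτ) Q) := by
  have hρ0 : 0 ≤ ρ := fun ω => (hρ_pos ω).le
  have hFG := le_enlargedFiltration F τ hτ
  have hη_adapted : StronglyAdapted (enlargedFiltration F τ hτ) η := fun t => by
    rw [show η t = fun ω => (P[ρ|F t]) ω / (P[ρ|enlargedFiltration F τ hτ t]) ω from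
      funext (hη t)]
    have he : StronglyMeasurable[enlargedFiltration F τ hτ t] (P[ρ|F t]) :=
      stronglyMeasurable_condExp.mono (hFG t)
    exact (he.measurable.div stronglyMeasurable_condExp.measurable).stronglyMeasurable
  have hmul : ∀ m : ℝ≥0 → Ω → ℝ, Martingale m F Q →
      Martingale (fun t ω => m t ω * η t ω) (enlargedFiltration F τ hτ) Q := by
    intro m hm
    have hadapted : StronglyAdapted (enlargedFiltration F τ hτ) fun t ω => m t ω * η t ω :=
      fun t => ((hm.1 t).mono (hFG t)).mul (hη_adapted t)
    rw [hQ] at hm ⊢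
    rw [martingale_withDensity_iff hρ0 hρ_int hadapted]
    have hadapted' : StronglyAdapted (enlargedFiltration F τ hτ)
        fun t ω => m t ω * η t ω * (P[ρ|enlargedFiltration F τ hτ t]) ω :=
      fun t => (hadapted t).mul stronglyMeasurable_condExp
    refine martingale_congr_ae
      (hImmP _ ((martingale_withDensity_iff hρ0 hρ_int hm.1).1 hm)) hadapted' fun t => ?_
    filter_upwards [hE_pos t] with ω hω
    rw [hη, mul_assoc, div_mul_cancel₀ _ hω.ne']
  refine ⟨?_, fun _ => hmul⟩
  have : IsFiniteMeasure Q := hQ ▸ isFiniteMeasure_withDensity_ofReal hρ_int.2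
  simpa using hmul (fun _ _ => 1) (martingale_const F Q 1)

end DefaultTimes
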